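/- Assume Σ_{x∈ℤ}(|α(x)−α₀| + |θ(x)|) < ∞. Then for every λ ∈ ℝ with |cos λ| < ρ₀, e^{iλ} is not an eigenvalue of U: there is no nonzero u ∈ l²(ℤ,ℂ²) with Uu = e^{iλ}u. If moreover Σ_{x∈ℤ}⟨x⟩(|α(x)−α₀| + |θ(x)|) < ∞, then also for every λ ∈ ℝ with |cos λ| = ρ₀, e^{iλ} is not an eigenvalue of U. -/

import Mathlib

open Complex Matrix

noncomputable section

/-- The coin matrix `C_{α,β,θ} = e^{iθ}[[β, conj α],[−α, conj β]]`. -/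
def coinMat (a b : ℂ) (t : ℝ) : Matrix (Fin 2) (Fin 2) ℂ :=
  Complex.exp ((t : ℂ) * Complex.I) • !![b, (starRingEnd ℂ) a; -a, (starRingEnd ℂ) b]

/-- The quantum walk evolution operator `U = SĈ`, acting on arbitrary `u : ℤ → ℂ²`:
`(Uu)↑(x) = (C(x−1)u(x−1))↑`, `(Uu)↓(x) = (C(x+1)u(x+1))↓`. -/
def qw (C : ℤ → Matrix (Fin 2) (Fin 2) ℂ) (u : ℤ → Fin 2 → ℂ) : ℤ → Fin 2 → ℂ :=
  fun x => ![(C (x - 1)).mulVec (u (x - 1)) 0, (C (x + 1)).mulVec (u (x + 1)) 1]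

/-- `ρ = √(1−|a|²)`. -/
def rho (a : ℂ) : ℝ := Real.sqrt (1 - ‖a‖ ^ 2)

/-- The coin map `x ↦ C_{α(x), ρ(x), θ(x)}`. -/
def coinOf (α : ℤ → ℂ) (θ : ℤ → ℝ) : ℤ → Matrix (Fin 2) (Fin 2) ℂ :=
  fun x => coinMat (α x) ((rho (α x) : ℝ) : ℂ) (θ x)

/-- The transfer matrix `T_λ(x)`. -/
def Tmat (α : ℤ → ℂ) (θ : ℤ → ℝ) (lam : ℂ) (x : ℤ) : Matrix (Fin 2) (Fin 2) ℂ :=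
  (((rho (α x) : ℝ) : ℂ))⁻¹ •
    !![Complex.exp (Complex.I * (lam - (θ x : ℂ))), α x;
       (starRingEnd ℂ) (α x), Complex.exp (-(Complex.I * (lam - (θ x : ℂ))))]

/-- `(J_VE u)(x) = (u↓(x−1), u↑(x))`. -/
def Jve (u : ℤ → Fin 2 → ℂ) : ℤ → Fin 2 → ℂ := fun x => ![u (x - 1) 1, u x 0]

/-- `(J_EV v)(x) = (v↓(x), v↑(x+1))`, the inverse of `J_VE`. -/
def Jev (v : ℤ → Fin 2 → ℂ) : ℤ → Fin 2 → ℂ := fun x => ![v x 1, v (x + 1) 0]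

/-- Determinant of the 2×2 matrix with columns `v, w`. -/
def det2 (v w : Fin 2 → ℂ) : ℂ := v 0 * w 1 - v 1 * w 0

/-- The Euclidean norm on ℂ². -/
def nrm2 (v : Fin 2 → ℂ) : ℝ := Real.sqrt (‖v 0‖ ^ 2 + ‖v 1‖ ^ 2)

/-- Membership in `l²(ℤ, ℂ²)`. -/
def MemL2 (u : ℤ → Fin 2 → ℂ) : Prop := Summable fun x : ℤ => ‖u x 0‖ ^ 2 + ‖u x 1‖ ^ 2

/-- The Japanese bracket `⟨x⟩ = √(1+x²)`. -/
def jp (x : ℤ) : ℝ := Real.sqrt (1 + (x : ℝ) ^ 2)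

/-- `w` is an eigenvalue of `U` (with an `l²` eigenvector). -/
def IsEigenvalue (α : ℤ → ℂ) (θ : ℤ → ℝ) (w : ℂ) : Prop :=
  ∃ u : ℤ → Fin 2 → ℂ, (∃ x : ℤ, u x ≠ 0) ∧ MemL2 u ∧
    ∀ x : ℤ, qw (coinOf α θ) u x = w • u x

open Filter Topology Asymptotics

theorem le_tsum_tail_of_le_succ_add {a g : ℕ → ℝ} {N : ℕ}
    (h : ∀ n, N ≤ n → a n ≤ a (n + 1) + g n) (ha : Tendsto a atTop (𝓝 0))
    (hg : Summable g) {n : ℕ} (hn : N ≤ n) : a n ≤ ∑' k, g (k + n) := by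
  have key : ∀ m, a n ≤ a (m + n) + ∑ k ∈ Finset.range m, g (k + n) := by
    intro m
    induction m with
    | zero => simp
    | succ m ih =>
      have h1 := h (m + n) (by omega)
      rw [Finset.sum_range_succ, show m + 1 + n = m + n + 1 by omega]
      linarith
  have hlim := ((tendsto_add_atTop_iff_nat n).2 ha).add
    ((summable_nat_add_iff n).2 hg).hasSum.tendsto_sum_nat
  rw [zero_add] at hlim
  exact ge_of_tendsto' hlim key

/-- A null sequence dominated by its own tails, weighted by a summable sequence, is eventually
zero. -/
theorem eventually_eq_zero_of_le_tsum_tail {s g : ℕ → ℝ} {N : ℕ} (hs : ∀ n, 0 ≤ s n)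
    (hs0 : Tendsto s atTop (𝓝 0)) (hg0 : ∀ n, 0 ≤ g n) (hg : Summable g)
    (h : ∀ n, N ≤ n → s n ≤ ∑' k, g (k + n) * s (k + n)) : ∀ᶠ n in atTop, s n = 0 := by
  obtain ⟨C, hC⟩ := hs0.bddAbove_range
  have hC' : ∀ n, s n ≤ C := fun n => hC ⟨n, rfl⟩
  have htail : ∀ᶠ n in atTop, ∑' k, g (k + n) < 1 / 2 :=
    (tendsto_sum_nat_add g).eventually_lt_const (by norm_num)
  obtain ⟨M, hM⟩ := eventually_atTop.1 htail
  have key : ∀ j : ℕ, ∀ n, max N M ≤ n → s n ≤ C * (1 / 2) ^ j := by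
    intro j
    induction j with
    | zero => intro n _; simpa using hC' n
    | succ j ih =>
      intro n hn
      have hgn : Summable fun k => g (k + n) := (summable_nat_add_iff n).2 hg
      have hle : ∀ k, g (k + n) * s (k + n) ≤ g (k + n) * (C * (1 / 2) ^ j) := fun k =>
        mul_le_mul_of_nonneg_left (ih _ (by omega)) (hg0 _)
      have hsum := Summable.of_nonneg_of_le (fun k => mul_nonneg (hg0 _) (hs _)) hle
        (hgn.mul_right _)
      calc s n ≤ ∑' k, g (k + n) * s (k + n) := h n (by omega)
        _ ≤ ∑' k, g (k + n) * (C * (1 / 2) ^ j) := hsum.tsum_le_tsum hle (hgn.mul_right _)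
        _ = (∑' k, g (k + n)) * (C * (1 / 2) ^ j) := tsum_mul_right
        _ ≤ 1 / 2 * (C * (1 / 2) ^ j) :=
          mul_le_mul_of_nonneg_right (hM n (by omega)).le
            (mul_nonneg ((hs 0).trans (hC' 0)) (by positivity))
        _ = C * (1 / 2) ^ (j + 1) := by ring
  filter_upwards [eventually_ge_atTop (max N M)] with n hn
  refine le_antisymm ?_ (hs n)
  have hlim : Tendsto (fun j : ℕ => C * (1 / 2 : ℝ) ^ j) atTop (𝓝 (C * 0)) :=
    (tendsto_pow_atTop_nhds_zero_of_lt_one (by norm_num) (by norm_num)).const_mul C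
  rw [mul_zero] at hlim
  exact ge_of_tendsto' hlim fun j => key j n hn

/-- Null sequences obeying backward triangular inequalities with coupling `B` and small relative
errors `e` are eventually zero. -/
theorem eventually_eq_zero_of_triangular {a b e : ℕ → ℝ} {B : ℝ} {N : ℕ}
    (ha0 : ∀ n, 0 ≤ a n) (hb0 : ∀ n, 0 ≤ b n) (he0 : ∀ n, 0 ≤ e n) (hB : 0 ≤ B)
    (ha : Tendsto a atTop (𝓝 0)) (hb : Tendsto b atTop (𝓝 0))
    (he : Summable fun n : ℕ => (2 + B * (n + 1)) * e n)
    (hab : ∀ n, N ≤ n → a n ≤ a (n + 1) + (B * b n + e n * (a n + b n)))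
    (hbb : ∀ n, N ≤ n → b n ≤ b (n + 1) + e n * (a n + b n)) :
    ∀ᶠ n in atTop, a n + b n = 0 := by
  have hs0 : ∀ n, 0 ≤ a n + b n := fun n => add_nonneg (ha0 n) (hb0 n)
  have hs : Tendsto (fun n => a n + b n) atTop (𝓝 0) := by simpa using ha.add hb
  obtain ⟨C, hC⟩ := hs.bddAbove_range
  have hC' : ∀ n, a n + b n ≤ C := fun n => hC ⟨n, rfl⟩
  have hBn : ∀ n : ℕ, 0 ≤ B * n := fun n => by positivity
  have dom : ∀ w : ℕ → ℝ, (∀ n, 0 ≤ w n) → (∀ n : ℕ, w n ≤ 2 + B * (n + 1)) →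
      Summable fun n => w n * (e n * (a n + b n)) := by
    intro w hw0 hw
    refine Summable.of_nonneg_of_le
      (fun n => mul_nonneg (hw0 n) (mul_nonneg (he0 n) (hs0 n))) (fun n => ?_) (he.mul_right C)
    rw [← mul_assoc]
    have := hBn n
    gcongr
    · exact hs0 n
    · exact mul_nonneg (by linarith) (he0 n)
    · exact he0 n
    · exact hw n
    · exact hC' n
  have hes : Summable fun n => e n * (a n + b n) := by
    simpa using dom (fun _ => 1) (fun _ => zero_le_one) (fun n => by
      have := hBn n; linarith)
  have hnes : Summable fun n : ℕ => (B * n) * (e n * (a n + b n)) :=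
    dom _ hBn (fun n => by linarith)
  have hces : Summable fun n : ℕ => (1 + B * (n + 1)) * (e n * (a n + b n)) :=
    dom _ (fun n => by have := hBn n; linarith) (fun n => by linarith)
  have hbt : ∀ n, N ≤ n → b n ≤ ∑' k, e (k + n) * (a (k + n) + b (k + n)) := fun n hn =>
    le_tsum_tail_of_le_succ_add hbb hb hes hn
  have hnb : Tendsto (fun n : ℕ => (B * n) * b n) atTop (𝓝 0) := by
    refine tendsto_of_tendsto_of_tendsto_of_le_of_le' tendsto_const_nhds
      (tendsto_sum_nat_add fun n : ℕ => (B * n) * (e n * (a n + b n)))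
      (Eventually.of_forall fun n => mul_nonneg (hBn n) (hb0 n)) ?_
    filter_upwards [eventually_ge_atTop N] with n hn
    refine (mul_le_mul_of_nonneg_left (hbt n hn) (hBn n)).trans ?_
    rw [← tsum_mul_left]
    refine Summable.tsum_le_tsum (fun k => ?_)
      (((summable_nat_add_iff n).2 hes).mul_left _) ((summable_nat_add_iff n).2 hnes)
    refine mul_le_mul_of_nonneg_right ?_ (mul_nonneg (he0 _) (hs0 _))
    push_cast
    nlinarith [hBn k]
  have hct : ∀ n, N ≤ n → a n + (B * n) * b n ≤
      ∑' k, (1 + B * ((k + n : ℕ) + 1)) * (e (k + n) * (a (k + n) + b (k + n))) := by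
    intro n hn
    refine le_tsum_tail_of_le_succ_add (a := fun n : ℕ => a n + (B * n) * b n) (N := N)
      (g := fun n : ℕ => (1 + B * (n + 1)) * (e n * (a n + b n))) ?_
      (by simpa using ha.add hnb) hces hn
    intro m hm
    have h1 := hab m hm
    have h2 := mul_le_mul_of_nonneg_left (hbb m hm) (hBn (m + 1))
    push_cast at h2 ⊢
    linarith
  refine eventually_eq_zero_of_le_tsum_tail (N := N) hs0 hs
    (fun n => mul_nonneg (by have := hBn n; linarith) (he0 n)) he fun n hn => ?_
  calc a n + b n ≤ (a n + (B * n) * b n) + b n := by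
        have := mul_nonneg (hBn n) (hb0 n); linarith
    _ ≤ _ := add_le_add (hct n hn) (hbt n hn)
    _ = _ := by
      rw [← ((summable_nat_add_iff n).2 hces).tsum_add ((summable_nat_add_iff n).2 hes)]
      exact tsum_congr fun k => by ring

/-- A null solution of `v (n + 1) = T n v n` is eventually zero if `T n` converges fast enough to
a matrix that is triangularized by `P` with unimodular eigenvalues. -/
theorem eventually_eq_zero_of_triangularizable {T : ℕ → Matrix (Fin 2) (Fin 2) ℂ}
    {T₀ P : Matrix (Fin 2) (Fin 2) ℂ} {μ ν b : ℂ} {e : ℕ → ℝ} {v : ℕ → Fin 2 → ℂ}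
    (hP : IsUnit P.det) (hPT : P * T₀ = !![μ, b; 0, ν] * P) (hμ : ‖μ‖ = 1) (hν : ‖ν‖ = 1)
    (he0 : ∀ n, 0 ≤ e n) (he : Summable fun n : ℕ => (2 + ‖b‖ * (n + 1)) * e n)
    (hT : ∀ i j, (fun n => T n i j - T₀ i j) =O[atTop] e)
    (hrec : ∀ n, v (n + 1) = T n *ᵥ v n) (hv : ∀ i, Tendsto (fun n => v n i) atTop (𝓝 0)) :
    ∀ᶠ n in atTop, v n = 0 := by
  set w : ℕ → Fin 2 → ℂ := fun n => P *ᵥ v n with hw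
  set R : ℕ → Matrix (Fin 2) (Fin 2) ℂ := fun n => P * (T n - T₀) * P⁻¹ with hR
  have hvw : ∀ n, v n = P⁻¹ *ᵥ w n := fun n => by
    rw [hw, Matrix.mulVec_mulVec, Matrix.nonsing_inv_mul P hP, Matrix.one_mulVec]
  have hwrec : ∀ n, w (n + 1) = !![μ, b; 0, ν] *ᵥ w n + R n *ᵥ w n := by
    intro n
    simp only [hR, ← Matrix.mulVec_mulVec, ← hvw]
    simp only [hw, hrec, Matrix.mulVec_mulVec, ← hPT, ← Matrix.add_mulVec]
    congr 1
    rw [Matrix.mul_sub]; abel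
  have hwlim : ∀ i, Tendsto (fun n => ‖w n i‖) atTop (𝓝 0) := by
    intro i
    have := ((hv 0).const_mul (P i 0)).add ((hv 1).const_mul (P i 1))
    have hwi : ∀ n, w n i = P i 0 * v n 0 + P i 1 * v n 1 := fun n => by
      simp only [hw, Matrix.mulVec, dotProduct, Fin.sum_univ_two]
    simp only [hwi]
    simpa using this.norm
  have hRO : ∀ i j, (fun n => R n i j) =O[atTop] e := by
    intro i j
    simp only [hR, Matrix.mul_apply, Matrix.sub_apply]
    refine IsBigO.fun_sum fun k _ => ?_
    simp_rw [mul_comm _ (P⁻¹ k j)]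
    refine IsBigO.const_mul_left (IsBigO.fun_sum fun l _ => ?_) _
    exact (hT l k).const_mul_left _
  choose c hc using fun i j => (hRO i j).bound
  set K : ℝ := |c 0 0| + |c 0 1| + |c 1 0| + |c 1 1| with hK
  have hK0 : 0 ≤ K := by positivity
  have hcK : ∀ i j, c i j ≤ K := by
    intro i j
    have h00 := abs_nonneg (c 0 0)
    have h01 := abs_nonneg (c 0 1)
    have h10 := abs_nonneg (c 1 0)
    have h11 := abs_nonneg (c 1 1)
    refine (le_abs_self _).trans ?_
    fin_cases i <;> fin_cases j <;> simp [hK] <;> linarith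
  have hev : ∀ᶠ n in atTop, ∀ i j, ‖R n i j‖ ≤ K * e n := by
    refine eventually_all.2 fun i => eventually_all.2 fun j => ?_
    filter_upwards [hc i j] with n hn
    rw [Real.norm_of_nonneg (he0 n)] at hn
    exact hn.trans (mul_le_mul_of_nonneg_right (hcK i j) (he0 n))
  obtain ⟨N, hN⟩ := eventually_atTop.1 hev
  have herr : ∀ i n, N ≤ n → ‖R n i 0 * w n 0 + R n i 1 * w n 1‖ ≤
      K * e n * (‖w n 0‖ + ‖w n 1‖) := by
    intro i n hn
    refine (norm_add_le _ _).trans ?_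
    rw [norm_mul, norm_mul, mul_add]
    gcongr
    · exact hN n hn i 0
    · exact hN n hn i 1
  have hfin := eventually_eq_zero_of_triangular (a := fun n => ‖w n 0‖) (b := fun n => ‖w n 1‖)
    (e := fun n => K * e n) (B := ‖b‖) (N := N) (fun _ => norm_nonneg _) (fun _ => norm_nonneg _)
    (fun n => mul_nonneg hK0 (he0 n)) (norm_nonneg b) (hwlim 0) (hwlim 1)
    ((he.mul_left K).congr fun n => by ring) ?_ ?_
  · filter_upwards [hfin] with n hn
    have h0 : w n 0 = 0 := norm_eq_zero.1 (by
      have := norm_nonneg (w n 0); have := norm_nonneg (w n 1); linarith)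
    have h1 : w n 1 = 0 := norm_eq_zero.1 (by
      have := norm_nonneg (w n 0); have := norm_nonneg (w n 1); linarith)
    have : w n = 0 := by ext i; fin_cases i <;> simp [h0, h1]
    rw [hvw, this, Matrix.mulVec_zero]
  · intro n hn
    have h := congrFun (hwrec n) 0
    simp only [Pi.add_apply, Matrix.mulVec, dotProduct, Fin.sum_univ_two, Matrix.of_apply,
      Matrix.cons_val_zero, Matrix.cons_val_one] at h
    have h2 : μ * w n 0 = w (n + 1) 0 - (b * w n 1 + (R n 0 0 * w n 0 + R n 0 1 * w n 1)) := by
      rw [h]; ring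
    calc ‖w n 0‖ = ‖μ * w n 0‖ := by rw [norm_mul, hμ, one_mul]
      _ ≤ ‖w (n + 1) 0‖ + (‖b * w n 1‖ + ‖R n 0 0 * w n 0 + R n 0 1 * w n 1‖) := by
        rw [h2]
        exact (norm_sub_le _ _).trans (by gcongr; exact norm_add_le _ _)
      _ ≤ _ := by rw [norm_mul]; gcongr; exact herr 0 n hn
  · intro n hn
    have h := congrFun (hwrec n) 1
    simp only [Pi.add_apply, Matrix.mulVec, dotProduct, Fin.sum_univ_two, Matrix.of_apply,
      Matrix.cons_val_zero, Matrix.cons_val_one] at h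
    have h2 : ν * w n 1 = w (n + 1) 1 - (R n 1 0 * w n 0 + R n 1 1 * w n 1) := by
      rw [h]; ring
    calc ‖w n 1‖ = ‖ν * w n 1‖ := by rw [norm_mul, hν, one_mul]
      _ ≤ ‖w (n + 1) 1‖ + ‖R n 1 0 * w n 0 + R n 1 1 * w n 1‖ := by
        rw [h2]; exact norm_sub_le _ _
      _ ≤ _ := by gcongr; exact herr 1 n hn

theorem rho_pos {a : ℂ} (ha : ‖a‖ < 1) : 0 < rho a :=
  Real.sqrt_pos.2 (by nlinarith [norm_nonneg a])

theorem rho_sq {a : ℂ} (ha : ‖a‖ < 1) : rho a ^ 2 = 1 - ‖a‖ ^ 2 :=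
  Real.sq_sqrt (by nlinarith [norm_nonneg a])

theorem ofReal_rho_sq {a : ℂ} (ha : ‖a‖ < 1) :
    ((rho a : ℝ) : ℂ) ^ 2 = 1 - a * (starRingEnd ℂ) a := by
  rw [Complex.mul_conj, Complex.normSq_eq_norm_sq]
  exact_mod_cast congrArg (fun r : ℝ => (r : ℂ)) (rho_sq ha)

theorem differentiableAt_ofReal_rho_inv {a : ℂ} (ha : ‖a‖ < 1) (t : ℝ) :
    DifferentiableAt ℝ (fun z : ℂ × ℝ => (((rho z.1 : ℝ) : ℂ))⁻¹) (a, t) := by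
  have h1 : DifferentiableAt ℝ (fun z : ℂ × ℝ => rho z.1) (a, t) := by
    unfold rho
    refine DifferentiableAt.sqrt ?_ (by simp only; nlinarith [norm_nonneg a])
    exact (differentiableAt_const _).sub (differentiableAt_fst.norm_sq ℝ)
  exact (Complex.ofRealCLM.differentiableAt.comp _ h1).inv
    (by simpa using (rho_pos ha).ne')

/-- The transfer matrices approach the free one at the rate of the perturbation. -/
theorem Tmat_sub_isBigO {α : ℤ → ℂ} {θ : ℤ → ℝ} {α₀ : ℂ} (h₁ : ‖α₀‖ < 1) (lam : ℂ)
    {l : Filter ℕ} (hlim : Tendsto (fun n : ℕ => ‖α n - α₀‖ + |θ n|) l (𝓝 0)) (i j : Fin 2) :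
    (fun n : ℕ => Tmat α θ lam n i j - Tmat (fun _ => α₀) (fun _ => 0) lam 0 i j) =O[l]
      fun n : ℕ => ‖α n - α₀‖ + |θ n| := by
  set F : ℂ × ℝ → ℂ := fun z => Tmat (fun _ => z.1) (fun _ => z.2) lam 0 i j with hF
  have hd : DifferentiableAt ℝ F (α₀, 0) := by
    have hr := differentiableAt_ofReal_rho_inv h₁ 0
    have ht : DifferentiableAt ℝ (fun z : ℂ × ℝ => (z.2 : ℂ)) (α₀, 0) :=
      Complex.ofRealCLM.differentiableAt.comp _ differentiableAt_snd
    have hc : DifferentiableAt ℝ (fun z : ℂ × ℝ => (starRingEnd ℂ) z.1) (α₀, 0) :=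
      Complex.conjCLE.differentiableAt.comp _ differentiableAt_fst
    have hm : DifferentiableAt ℝ (fun z : ℂ × ℝ => Complex.I * (lam - (z.2 : ℂ))) (α₀, 0) :=
      (ht.const_sub _).const_mul _
    fin_cases i <;> fin_cases j <;> simp only [hF, Tmat, Matrix.smul_apply, smul_eq_mul] <;>
      refine hr.mul ?_ <;> simp
    · exact hm.cexp
    · exact hc
    · exact hm.neg.cexp
  have hdist : (fun n : ℕ => (α n, θ n) - (α₀, (0 : ℝ))) =O[l]
      fun n : ℕ => ‖α n - α₀‖ + |θ n| := by
    refine IsBigO.of_bound 1 (Eventually.of_forall fun n => ?_)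
    rw [one_mul, Real.norm_of_nonneg (by positivity), Prod.mk_sub_mk, Prod.norm_mk, sub_zero,
      Real.norm_eq_abs]
    exact max_le_add_of_nonneg (norm_nonneg _) (abs_nonneg _)
  have hto : Tendsto (fun n : ℕ => (α n, θ n)) l (𝓝 (α₀, (0 : ℝ))) :=
    tendsto_sub_nhds_zero_iff.1 (hdist.trans_tendsto hlim)
  exact (hd.hasFDerivAt.isBigO_sub.comp_tendsto hto).trans hdist

theorem eigen_relations {α : ℤ → ℂ} {θ : ℤ → ℝ} {w : ℂ} {u : ℤ → Fin 2 → ℂ}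
    (hu : ∀ x : ℤ, qw (coinOf α θ) u x = w • u x) (x : ℤ) :
    w * u (x + 1) 0 = Complex.exp (θ x * Complex.I) *
        (rho (α x) * u x 0 + (starRingEnd ℂ) (α x) * u x 1) ∧
      w * u (x - 1) 1 = Complex.exp (θ x * Complex.I) *
        (-α x * u x 0 + rho (α x) * u x 1) := by
  have h0 := congrFun (hu (x + 1)) 0
  have h1 := congrFun (hu (x - 1)) 1
  simp [qw, coinOf, coinMat, Matrix.mulVec, dotProduct, Fin.sum_univ_two] at h0 h1
  constructor
  · rw [← h0]; ring
  · rw [← h1]; ring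

/-- Eigenfunctions of the walk solve the transfer matrix recursion. -/
theorem Jve_succ_eq_mulVec {α : ℤ → ℂ} {θ : ℤ → ℝ} (hα : ∀ x : ℤ, ‖α x‖ < 1) {lam : ℂ}
    {u : ℤ → Fin 2 → ℂ}
    (hu : ∀ x : ℤ, qw (coinOf α θ) u x = Complex.exp (Complex.I * lam) • u x) (x : ℤ) :
    Jve u (x + 1) = Tmat α θ lam x *ᵥ Jve u x := by
  obtain ⟨h0, h1⟩ := eigen_relations hu x
  have hr : ((rho (α x) : ℝ) : ℂ) ≠ 0 := by exact_mod_cast (rho_pos (hα x)).ne'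
  have hr2 := ofReal_rho_sq (hα x)
  have hE : Complex.exp (Complex.I * (lam - (θ x : ℂ))) =
      Complex.exp (Complex.I * lam) / Complex.exp (θ x * Complex.I) := by
    rw [← Complex.exp_sub]; congr 1; ring
  have ht := Complex.exp_ne_zero (θ x * Complex.I)
  have hl := Complex.exp_ne_zero (Complex.I * lam)
  have hv : Jve u (x + 1) = ![u x 1, u (x + 1) 0] := by simp [Jve]
  rw [hv, Tmat, Complex.exp_neg, hE]
  generalize Complex.exp (θ x * Complex.I) = t at h0 h1 ht
  generalize Complex.exp (Complex.I * lam) = z at h0 h1 hl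
  ext i
  fin_cases i
  · simp [Jve, Matrix.mulVec, dotProduct, Fin.sum_univ_two]
    field_simp
    linear_combination -h1
  · simp [Jve, Matrix.mulVec, dotProduct, Fin.sum_univ_two]
    field_simp
    linear_combination (rho (α x) : ℂ) * h0 - (starRingEnd ℂ) (α x) * h1 +
      t * u x 0 * hr2

theorem Jve_eq_zero_of_succ {α : ℤ → ℂ} {θ : ℤ → ℝ} (hα : ∀ x : ℤ, ‖α x‖ < 1) {w : ℂ}
    (hw : w ≠ 0) {u : ℤ → Fin 2 → ℂ} (hu : ∀ x : ℤ, qw (coinOf α θ) u x = w • u x) {x : ℤ}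
    (hx : Jve u (x + 1) = 0) : Jve u x = 0 := by
  obtain ⟨h0, h1⟩ := eigen_relations hu x
  have hr : ((rho (α x) : ℝ) : ℂ) ≠ 0 := by exact_mod_cast (rho_pos (hα x)).ne'
  have hd : u x 1 = 0 := by simpa [Jve] using congrFun hx 0
  have hn : u (x + 1) 0 = 0 := by simpa [Jve] using congrFun hx 1
  have hup : u x 0 = 0 := by simpa [hd, hn, hr] using h0
  have hdn : u (x - 1) 1 = 0 := by simpa [hd, hup, hw] using h1
  ext i
  fin_cases i <;> simp [Jve, hup, hdn]

/-- If the free transfer matrix is triangularizable with unimodular eigenvalues, a fast decaying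
perturbation has no eigenvalue there. -/
theorem not_isEigenvalue_of_triangularizable {α₀ : ℂ} (h₁ : ‖α₀‖ < 1) {α : ℤ → ℂ} {θ : ℤ → ℝ}
    (hα : ∀ x : ℤ, ‖α x‖ < 1) (hsum : Summable fun x : ℤ => ‖α x - α₀‖ + |θ x|) {lam : ℂ}
    {P : Matrix (Fin 2) (Fin 2) ℂ} {μ ν b : ℂ} (hP : IsUnit P.det)
    (hPT : P * Tmat (fun _ => α₀) (fun _ => 0) lam 0 = !![μ, b; 0, ν] * P)
    (hμ : ‖μ‖ = 1) (hν : ‖ν‖ = 1)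
    (hb : Summable fun n : ℕ => (2 + ‖b‖ * (n + 1)) * (‖α n - α₀‖ + |θ n|)) :
    ¬ IsEigenvalue α θ (Complex.exp (Complex.I * lam)) := by
  rintro ⟨u, ⟨x, hx⟩, hu2, hu⟩
  have hinj : Function.Injective (fun n : ℕ => (n : ℤ)) := Nat.cast_injective
  have hcoord : ∀ i, Tendsto (fun x : ℤ => u x i) cofinite (𝓝 0) := by
    intro i
    have hs : Summable fun x : ℤ => ‖u x i‖ ^ 2 :=
      Summable.of_nonneg_of_le (fun x => by positivity)
        (fun x => by fin_cases i <;> simp) hu2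
    have hsq := (Real.continuous_sqrt.tendsto 0).comp hs.tendsto_cofinite_zero
    rw [Real.sqrt_zero] at hsq
    exact tendsto_zero_iff_norm_tendsto_zero.2
      (hsq.congr fun x => Real.sqrt_sq (norm_nonneg _))
  have hcof : Tendsto (fun n : ℕ => (n : ℤ)) atTop cofinite := by
    rw [← Nat.cofinite_eq_atTop]; exact hinj.tendsto_cofinite
  have hcof' : Tendsto (fun n : ℕ => (n : ℤ) - 1) atTop cofinite := by
    rw [← Nat.cofinite_eq_atTop]
    exact ((sub_left_injective (b := (1 : ℤ))).comp hinj).tendsto_cofinite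
  have hzero := eventually_eq_zero_of_triangularizable (T := fun n : ℕ => Tmat α θ lam n)
    (v := fun n : ℕ => Jve u n) hP hPT hμ hν
    (e := fun n : ℕ => ‖α n - α₀‖ + |θ n|) (fun n => by positivity) hb
    (Tmat_sub_isBigO h₁ lam (hsum.tendsto_cofinite_zero.comp hcof))
    (fun n => by simpa using Jve_succ_eq_mulVec hα hu n)
    (fun i => by
      fin_cases i
      · exact (hcoord 1).comp hcof'
      · exact (hcoord 0).comp hcof)
  obtain ⟨N, hN⟩ := eventually_atTop.1 hzero
  have hall : ∀ y : ℤ, Jve u y = 0 := by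
    intro y
    rcases le_total (N : ℤ) y with hy | hy
    · lift y to ℕ using by omega
      exact hN y (by exact_mod_cast hy)
    · induction y, hy using Int.leInductionDown with
      | base => exact hN N le_rfl
      | pred n _ ih =>
        exact Jve_eq_zero_of_succ hα (Complex.exp_ne_zero _) hu (by simpa using ih)
  refine hx ?_
  ext i
  fin_cases i
  · simpa [Jve] using congrFun (hall x) 1
  · simpa [Jve] using congrFun (hall (x + 1)) 0

/-- The row vector `(conj α₀, m − e^{iλ})` is a left eigenvector of the free transfer matrix for
each root `m` of `m² − 2 m cos λ + ρ₀²`. -/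
theorem free_left_eigenvector {α₀ : ℂ} (h₁ : ‖α₀‖ < 1) {lam m : ℂ}
    (hm : m ^ 2 - 2 * Complex.cos lam * m + (rho α₀ : ℂ) ^ 2 = 0) :
    ![(starRingEnd ℂ) α₀, m - Complex.exp (Complex.I * lam)] ᵥ*
        Tmat (fun _ => α₀) (fun _ => 0) lam 0 =
      (m / rho α₀) • ![(starRingEnd ℂ) α₀, m - Complex.exp (Complex.I * lam)] := by
  have hr : ((rho α₀ : ℝ) : ℂ) ≠ 0 := by exact_mod_cast (rho_pos h₁).ne'
  have hr2 := ofReal_rho_sq h₁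
  have hl := Complex.exp_ne_zero (Complex.I * lam)
  have hcos : 2 * Complex.cos lam =
      Complex.exp (Complex.I * lam) + (Complex.exp (Complex.I * lam))⁻¹ := by
    rw [Complex.two_cos, ← Complex.exp_neg]; congr 2 <;> ring
  rw [hcos, hr2] at hm
  field_simp at hm
  ext i
  fin_cases i
  · simp [Tmat, Matrix.vecMul, dotProduct, Fin.sum_univ_two]
    field_simp
    ring
  · simp [Tmat, Matrix.vecMul, dotProduct, Fin.sum_univ_two, Complex.exp_neg]
    field_simp
    linear_combination -hm

/-- under an `l¹` perturbation there is no eigenvalue in the interior of the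
essential spectrum, and under an `l^{1,1}` perturbation none on its edge either. -/
theorem stmt6 (α₀ : ℂ) (h₀ : 0 < ‖α₀‖) (h₁ : ‖α₀‖ < 1)
    (α : ℤ → ℂ) (θ : ℤ → ℝ) (hα : ∀ x : ℤ, ‖α x‖ < 1)
    (hsum : Summable fun x : ℤ => ‖α x - α₀‖ + |θ x|) :
    (∀ lam : ℝ, |Real.cos lam| < rho α₀ →
        ¬ IsEigenvalue α θ (Complex.exp (Complex.I * (lam : ℂ)))) ∧
    ((Summable fun x : ℤ => jp x * (‖α x - α₀‖ + |θ x|)) →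
      ∀ lam : ℝ, |Real.cos lam| = rho α₀ →
        ¬ IsEigenvalue α θ (Complex.exp (Complex.I * (lam : ℂ)))) := by
  have hr0 := rho_pos h₁
  have hr : ((rho α₀ : ℝ) : ℂ) ≠ 0 := by exact_mod_cast hr0.ne'
  have hc0 : (starRingEnd ℂ) α₀ ≠ 0 := by simpa using norm_pos_iff.1 h₀
  have hinj : Function.Injective (fun n : ℕ => (n : ℤ)) := Nat.cast_injective
  have hrow : ∀ r s : Fin 2 → ℂ, ∀ M : Matrix (Fin 2) (Fin 2) ℂ,
      !![r 0, r 1; s 0, s 1] * M = !![(r ᵥ* M) 0, (r ᵥ* M) 1; (s ᵥ* M) 0, (s ᵥ* M) 1] := by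
    intro r s M
    ext i j
    fin_cases i <;> fin_cases j <;>
      simp [Matrix.mul_apply, Matrix.vecMul, dotProduct, Fin.sum_univ_two]
  refine ⟨fun lam hlam => ?_, fun hjp lam hlam => ?_⟩
  · set d := Real.sqrt (rho α₀ ^ 2 - Real.cos lam ^ 2) with hd
    have hpos : 0 < rho α₀ ^ 2 - Real.cos lam ^ 2 := by
      nlinarith [sq_abs (Real.cos lam), abs_nonneg (Real.cos lam)]
    have hd0 : 0 < d := Real.sqrt_pos.2 hpos
    have hd2 : d ^ 2 = rho α₀ ^ 2 - Real.cos lam ^ 2 := Real.sq_sqrt hpos.le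
    have hd2c : (d : ℂ) ^ 2 = (rho α₀ : ℂ) ^ 2 - Complex.cos lam ^ 2 := by
      exact_mod_cast congrArg (fun r : ℝ => (r : ℂ)) hd2
    have hroot : ∀ σ : ℝ, σ ^ 2 = 1 →
        (Complex.cos lam + (σ * d : ℝ) * Complex.I) ^ 2 -
            2 * Complex.cos lam * (Complex.cos lam + (σ * d : ℝ) * Complex.I) +
          (rho α₀ : ℂ) ^ 2 = 0 := by
      intro σ hσ
      have hσc : (σ : ℂ) ^ 2 = 1 := by exact_mod_cast hσ
      push_cast
      linear_combination (σ : ℂ) ^ 2 * (d : ℂ) ^ 2 * Complex.I_sq - (d : ℂ) ^ 2 * hσc - hd2c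
    have hnorm : ∀ σ : ℝ, σ ^ 2 = 1 →
        ‖(Complex.cos lam + (σ * d : ℝ) * Complex.I) / (rho α₀ : ℂ)‖ = 1 := by
      intro σ hσ
      rw [norm_div, ← Complex.ofReal_cos, Complex.norm_add_mul_I, Complex.norm_real,
        Real.norm_of_nonneg hr0.le, mul_pow, hσ, one_mul, hd2, add_sub_cancel,
        Real.sqrt_sq hr0.le, div_self hr0.ne']
    have e1 := free_left_eigenvector h₁ (hroot 1 (by norm_num))
    have e2 := free_left_eigenvector h₁ (hroot (-1) (by norm_num))
    set m₁ := Complex.cos lam + (1 * d : ℝ) * Complex.I with hm₁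
    set m₂ := Complex.cos lam + (-1 * d : ℝ) * Complex.I with hm₂
    refine not_isEigenvalue_of_triangularizable h₁ hα hsum (b := 0) (μ := m₁ / rho α₀)
      (ν := m₂ / rho α₀)
      (P := !![(starRingEnd ℂ) α₀, m₁ - Complex.exp (Complex.I * lam);
        (starRingEnd ℂ) α₀, m₂ - Complex.exp (Complex.I * lam)]) ?_ ?_
      (hnorm 1 (by norm_num)) (hnorm (-1) (by norm_num)) ?_
    · rw [Matrix.det_fin_two_of, isUnit_iff_ne_zero]
      have : (starRingEnd ℂ) α₀ * (m₂ - Complex.exp (Complex.I * lam)) -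
          (m₁ - Complex.exp (Complex.I * lam)) * (starRingEnd ℂ) α₀ =
          (starRingEnd ℂ) α₀ * (-2 * d * Complex.I) := by
        rw [hm₁, hm₂]; push_cast; ring
      rw [this]
      have : (d : ℂ) ≠ 0 := by exact_mod_cast hd0.ne'
      simp [this] at hc0 ⊢
      exact hc0
    · have := hrow ![(starRingEnd ℂ) α₀, m₁ - Complex.exp (Complex.I * lam)]
        ![(starRingEnd ℂ) α₀, m₂ - Complex.exp (Complex.I * lam)]
        (Tmat (fun _ => α₀) (fun _ => 0) lam 0)
      rw [e1, e2] at this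
      simp only [Matrix.cons_val_zero, Matrix.cons_val_one, Pi.smul_apply, smul_eq_mul] at this
      rw [this]
      ext i j
      fin_cases i <;> fin_cases j <;> simp
    · simpa using (hsum.comp_injective hinj).mul_left 2
  · have hcos2 : Real.cos lam ^ 2 = rho α₀ ^ 2 := by rw [← hlam, sq_abs]
    have hcos2c : Complex.cos lam ^ 2 = (rho α₀ : ℂ) ^ 2 := by
      exact_mod_cast congrArg (fun r : ℝ => (r : ℂ)) hcos2
    have e1 := free_left_eigenvector (lam := lam) (m := Complex.cos lam) h₁
      (by linear_combination -hcos2c)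
    have hnorm : ‖Complex.cos lam / (rho α₀ : ℂ)‖ = 1 := by
      rw [norm_div, ← Complex.ofReal_cos, Complex.norm_real, Complex.norm_real,
        Real.norm_eq_abs, hlam, Real.norm_of_nonneg hr0.le, div_self hr0.ne']
    have htwo : 2 * Complex.cos lam =
        Complex.exp (Complex.I * lam) + Complex.exp (-(Complex.I * lam)) := by
      rw [Complex.two_cos]; congr 2 <;> ring
    refine not_isEigenvalue_of_triangularizable h₁ hα hsum (b := (rho α₀ : ℂ)⁻¹)
      (μ := Complex.cos lam / rho α₀) (ν := Complex.cos lam / rho α₀)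
      (P := !![0, 1; (starRingEnd ℂ) α₀, Complex.cos lam - Complex.exp (Complex.I * lam)]) ?_ ?_
      hnorm hnorm ?_
    · rw [Matrix.det_fin_two_of, isUnit_iff_ne_zero]
      simpa using hc0
    · have := hrow ![0, 1]
        ![(starRingEnd ℂ) α₀, Complex.cos lam - Complex.exp (Complex.I * lam)]
        (Tmat (fun _ => α₀) (fun _ => 0) lam 0)
      rw [e1] at this
      simp only [Matrix.cons_val_zero, Matrix.cons_val_one, Pi.smul_apply, smul_eq_mul] at this
      rw [this]
      ext i j
      fin_cases i <;> fin_cases j <;>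
        simp [Tmat, Matrix.vecMul, dotProduct, Fin.sum_univ_two]
      field_simp
      linear_combination -htwo
    · have hj := hjp.comp_injective hinj
      refine Summable.of_nonneg_of_le (fun n => by positivity) (fun n => ?_)
        (hj.mul_left (2 + ‖(rho α₀ : ℂ)⁻¹‖ * 2))
      simp only [Function.comp, ← mul_assoc]
      refine mul_le_mul_of_nonneg_right ?_ (by positivity)
      have hone : 1 ≤ jp n := Real.one_le_sqrt.2 (by nlinarith [sq_nonneg ((n : ℤ) : ℝ)])
      have hn : (n : ℝ) ≤ jp n := Real.le_sqrt_of_sq_le (by push_cast; linarith)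
      nlinarith [norm_nonneg ((rho α₀ : ℂ)⁻¹),
        mul_le_mul_of_nonneg_left (add_le_add hn hone) (norm_nonneg ((rho α₀ : ℂ)⁻¹))]
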